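/- Let 0 < r̲ ≤ r̄ ≤ R, let γ = log 2, and assume Δt < 1/R and Δx < (1/16)·√(2γr̲)·Δt. If c̄ > 0 is the unique positive solution of I(c̄) = log(1 + r̄Δt), then (1/2)·√(2γr̲)·Δt < c̄ < 2·√(2R)·Δt. -/

import Mathlib

open MeasureTheory Real Set

/-- The discretized Gaussian weight `μ(j)`. -/
noncomputable def gaussMu (Δt Δx : ℝ) (j : ℤ) : ℝ :=
  ∫ x in (((j : ℝ) - 1/2) * Δx)..(((j : ℝ) + 1/2) * Δx),
    (Real.sqrt (2 * Real.pi * Δt))⁻¹ * Real.exp (-x ^ 2 / (2 * Δt))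

/-- The log-moment generating function `Λ` of the discretized Gaussian. -/
noncomputable def LambdaFn (Δt Δx : ℝ) (l : ℝ) : ℝ :=
  Real.log (∑' j : ℤ, gaussMu Δt Δx j * Real.exp (l * (j * Δx)))

/-- The convex conjugate (rate function) `I(y) = sup_λ (λy − Λ(λ))`. -/
noncomputable def rateI (Δt Δx : ℝ) (y : ℝ) : ℝ :=
  ⨆ l : ℝ, l * y - LambdaFn Δt Δx l

lemma aux_integrand (t l x : ℝ) (ht : 0 < t) :
    ((Real.sqrt (2 * Real.pi * t))⁻¹ * Real.exp (-x ^ 2 / (2 * t))) * Real.exp (l * x)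
      = Real.exp (l ^ 2 * t / 2) * ProbabilityTheory.gaussianPDFReal (l * t) t.toNNReal x := by
  rw [ProbabilityTheory.gaussianPDFReal, Real.coe_toNNReal t ht.le, mul_assoc, ← Real.exp_add,
    mul_left_comm, ← Real.exp_add]
  congr 2
  field_simp
  ring

lemma aux_integrable (t l : ℝ) (ht : 0 < t) :
    Integrable (fun x : ℝ => ((Real.sqrt (2 * Real.pi * t))⁻¹ * Real.exp (-x ^ 2 / (2 * t)))
      * Real.exp (l * x)) := by
  simp_rw [aux_integrand t l _ ht]
  exact (ProbabilityTheory.integrable_gaussianPDFReal _ _).const_mul _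

lemma aux_integral (t l : ℝ) (ht : 0 < t) :
    ∫ x : ℝ, ((Real.sqrt (2 * Real.pi * t))⁻¹ * Real.exp (-x ^ 2 / (2 * t)))
      * Real.exp (l * x) = Real.exp (l ^ 2 * t / 2) := by
  simp_rw [aux_integrand t l _ ht]
  rw [integral_const_mul, ProbabilityTheory.integral_gaussianPDFReal_eq_one, mul_one]
  simpa using ht

lemma aux_hasSum (d : ℝ) (hd : 0 < d) (f : ℝ → ℝ) (hf : Integrable f) :
    HasSum (fun j : ℤ => ∫ x in (((j : ℝ) - 1/2) * d)..(((j : ℝ) + 1/2) * d), f x)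
      (∫ x, f x) := by
  have h := hasSum_integral_iUnion (μ := volume) (f := f)
    (s := fun n : ℤ => Ioc (-(d/2) + n • d) (-(d/2) + (n + 1) • d))
    (fun _ => measurableSet_Ioc) (pairwise_disjoint_Ioc_add_zsmul _ _) hf.integrableOn
  rw [iUnion_Ioc_add_zsmul hd, Measure.restrict_univ] at h
  refine (congrArg (fun F : ℤ → ℝ => HasSum F (∫ x, f x)) (funext fun j => ?_)).mpr h
  rw [intervalIntegral.integral_of_le (by nlinarith)]
  have h1 : ((j : ℝ) - 1/2) * d = -(d/2) + j • d := by simp; ring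
  have h2 : ((j : ℝ) + 1/2) * d = -(d/2) + (j + 1) • d := by simp; ring
  rw [h1, h2]

lemma aux_abs (d l x : ℝ) (j : ℤ)
    (hx : x ∈ Icc (((j : ℝ) - 1/2) * d) (((j : ℝ) + 1/2) * d)) :
    |l * (j * d) - l * x| ≤ |l| * (d / 2) := by
  rw [← mul_sub, abs_mul]
  refine mul_le_mul_of_nonneg_left ?_ (abs_nonneg l)
  rw [abs_le]
  constructor <;> linarith [hx.1, hx.2]

lemma aux_term (t d l : ℝ) (ht : 0 < t) (hd : 0 < d) (j : ℤ) :
    Real.exp (-(|l| * (d / 2))) * (∫ x in (((j : ℝ) - 1/2) * d)..(((j : ℝ) + 1/2) * d),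
      ((Real.sqrt (2 * Real.pi * t))⁻¹ * Real.exp (-x ^ 2 / (2 * t))) * Real.exp (l * x))
      ≤ gaussMu t d j * Real.exp (l * (j * d)) ∧
    gaussMu t d j * Real.exp (l * (j * d)) ≤
    Real.exp (|l| * (d / 2)) * (∫ x in (((j : ℝ) - 1/2) * d)..(((j : ℝ) + 1/2) * d),
      ((Real.sqrt (2 * Real.pi * t))⁻¹ * Real.exp (-x ^ 2 / (2 * t))) * Real.exp (l * x)) := by
  unfold gaussMu
  rw [← intervalIntegral.integral_const_mul, ← intervalIntegral.integral_const_mul,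
    ← intervalIntegral.integral_mul_const]
  have hle : ((j : ℝ) - 1/2) * d ≤ ((j : ℝ) + 1/2) * d := by nlinarith
  constructor
  · refine intervalIntegral.integral_mono_on hle ?_ ?_ ?_
    · exact Continuous.intervalIntegrable (by fun_prop) _ _
    · exact Continuous.intervalIntegrable (by fun_prop) _ _
    · intro x hx
      rw [mul_left_comm, ← Real.exp_add]
      refine mul_le_mul_of_nonneg_left (Real.exp_le_exp.2 ?_) (by positivity)
      linarith [(abs_le.1 (aux_abs d l x j hx)).1]
  · refine intervalIntegral.integral_mono_on hle ?_ ?_ ?_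
    · exact Continuous.intervalIntegrable (by fun_prop) _ _
    · exact Continuous.intervalIntegrable (by fun_prop) _ _
    · intro x hx
      rw [mul_left_comm (Real.exp (|l| * (d / 2))), ← Real.exp_add]
      refine mul_le_mul_of_nonneg_left (Real.exp_le_exp.2 ?_) (by positivity)
      linarith [(abs_le.1 (aux_abs d l x j hx)).2]

lemma aux_Lambda (t d l : ℝ) (ht : 0 < t) (hd : 0 < d) :
    l ^ 2 * t / 2 - |l| * (d / 2) ≤ LambdaFn t d l ∧
      LambdaFn t d l ≤ l ^ 2 * t / 2 + |l| * (d / 2) := by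
  have hS := aux_hasSum d hd _ (aux_integrable t l ht)
  rw [aux_integral t l ht] at hS
  have hlo := hS.mul_left (Real.exp (-(|l| * (d / 2))))
  have hhi := hS.mul_left (Real.exp (|l| * (d / 2)))
  have hnn : ∀ j : ℤ, 0 ≤ gaussMu t d j * Real.exp (l * (j * d)) := by
    intro j
    refine mul_nonneg ?_ (Real.exp_pos _).le
    exact intervalIntegral.integral_nonneg (by nlinarith) (fun x _ => by positivity)
  have hsum : Summable (fun j : ℤ => gaussMu t d j * Real.exp (l * (j * d))) :=
    Summable.of_nonneg_of_le hnn (fun j => (aux_term t d l ht hd j).2) hhi.summable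
  have h1 := hasSum_le (fun j => (aux_term t d l ht hd j).1) hlo hsum.hasSum
  have h2 := hasSum_le (fun j => (aux_term t d l ht hd j).2) hsum.hasSum hhi
  rw [← Real.exp_add] at h1 h2
  have hpos := (Real.exp_pos _).trans_le h1
  unfold LambdaFn
  constructor
  · rw [Real.le_log_iff_exp_le hpos]
    refine le_trans (Real.exp_le_exp.2 (by linarith)) h1
  · rw [Real.log_le_iff_le_exp hpos]
    refine le_trans h2 (Real.exp_le_exp.2 (by linarith))

lemma aux_upper (t d c l : ℝ) (ht : 0 < t) (hd : 0 < d) (hc : 0 < c) :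
    l * c - LambdaFn t d l ≤ (c + d / 2) ^ 2 / (2 * t) := by
  have h := (aux_Lambda t d l ht hd).1
  have h1 : l * c ≤ |l| * c := mul_le_mul_of_nonneg_right (le_abs_self l) hc.le
  have h2 : |l| * (c + d / 2) - |l| ^ 2 * t / 2 ≤ (c + d / 2) ^ 2 / (2 * t) := by
    rw [le_div_iff₀ (by positivity)]
    nlinarith [sq_nonneg (|l| * t - (c + d / 2))]
  rw [sq_abs] at h2
  linarith

lemma aux_rate_upper (t d c : ℝ) (ht : 0 < t) (hd : 0 < d) (hc : 0 < c) :
    rateI t d c ≤ (c + d / 2) ^ 2 / (2 * t) :=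
  ciSup_le (fun l => aux_upper t d c l ht hd hc)

lemma aux_rate_lower (t d c : ℝ) (ht : 0 < t) (hd : 0 < d) (hc : d / 2 ≤ c) :
    (c - d / 2) ^ 2 / (2 * t) ≤ rateI t d c := by
  have hb : BddAbove (range fun l : ℝ => l * c - LambdaFn t d l) :=
    ⟨(c + d / 2) ^ 2 / (2 * t), by
      rintro _ ⟨l, rfl⟩
      exact aux_upper t d c l ht hd (by linarith)⟩
  refine le_trans ?_ (le_ciSup hb ((c - d / 2) / t))
  have h := (aux_Lambda t d ((c - d / 2) / t) ht hd).2
  rw [abs_of_nonneg (div_nonneg (by linarith) ht.le)] at h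
  have e : (c - d / 2) ^ 2 / (2 * t) = (c - d / 2) / t * c -
      (((c - d / 2) / t) ^ 2 * t / 2 + (c - d / 2) / t * (d / 2)) := by
    field_simp
    ring
  linarith

lemma aux_log (x : ℝ) (h0 : 0 ≤ x) (h1 : x ≤ 1) : x * Real.log 2 ≤ Real.log (1 + x) := by
  have h := strictConcaveOn_log_Ioi.concaveOn.2 (show (1 : ℝ) ∈ Ioi 0 by simp) (show (2 : ℝ) ∈ Ioi 0 by simp)
    (show 0 ≤ 1 - x by linarith) h0 (by ring)
  simp only [smul_eq_mul, Real.log_one, mul_zero, zero_add] at h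
  rwa [show (1 - x) * 1 + x * 2 = 1 + x by ring] at h

/-- Let `0 < rlo ≤ rbar ≤ R`, `γ = log 2`, `Δt < 1/R` and `Δx < (1/16)√(2γ·rlo)·Δt`.
If `c̄ > 0` solves `I(c̄) = log(1 + rbar·Δt)`, then
`(1/2)√(2γ·rlo)·Δt < c̄ < 2√(2R)·Δt`. -/
theorem stmt_7 (Δt Δx : ℝ) (hΔt0 : 0 < Δt) (hΔx0 : 0 < Δx)
    (rlo rbar R : ℝ) (hrlo : 0 < rlo) (hlole : rlo ≤ rbar) (hleR : rbar ≤ R)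
    (hΔt : Δt < 1 / R)
    (hΔx : Δx < 1 / 16 * Real.sqrt (2 * Real.log 2 * rlo) * Δt)
    (c : ℝ) (hc : 0 < c) (hceq : rateI Δt Δx c = Real.log (1 + rbar * Δt)) :
    1 / 2 * Real.sqrt (2 * Real.log 2 * rlo) * Δt < c ∧
      c < 2 * Real.sqrt (2 * R) * Δt := by
  have hR : 0 < R := by linarith
  have hRt : R * Δt < 1 := by rwa [lt_div_iff₀ hR, mul_comm] at hΔt
  have hrb : 0 < rbar := by linarith
  have hl2 : 0 < Real.log 2 := Real.log_pos (by norm_num)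
  have hl2' : Real.log 2 < 1 := by linarith [Real.log_two_lt_d9]
  have ha2 : Real.sqrt (2 * Real.log 2 * rlo) ^ 2 = 2 * Real.log 2 * rlo :=
    Real.sq_sqrt (by positivity)
  have hb2 : Real.sqrt (2 * R) ^ 2 = 2 * R := Real.sq_sqrt (by positivity)
  have hap : 0 < Real.sqrt (2 * Real.log 2 * rlo) := Real.sqrt_pos.2 (by positivity)
  have hbp : 0 < Real.sqrt (2 * R) := Real.sqrt_pos.2 (by positivity)
  have hab : Real.sqrt (2 * Real.log 2 * rlo) ≤ Real.sqrt (2 * R) :=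
    Real.sqrt_le_sqrt (by nlinarith)
  set a := Real.sqrt (2 * Real.log 2 * rlo)
  set b := Real.sqrt (2 * R)
  have hat : 0 < a * Δt := mul_pos hap hΔt0
  have habt : a * Δt ≤ b * Δt := mul_le_mul_of_nonneg_right hab hΔt0.le
  constructor
  · have h1 := aux_rate_upper Δt Δx c hΔt0 hΔx0 hc
    have h2 := aux_log (rbar * Δt) (by positivity) (by nlinarith)
    rw [hceq] at h1
    have h3 : rlo * Δt * Real.log 2 ≤ rbar * Δt * Real.log 2 := by gcongr
    have h4 := (h3.trans h2).trans h1
    rw [le_div_iff₀ (by positivity)] at h4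
    have h5 : (a * Δt) ^ 2 ≤ (c + Δx / 2) ^ 2 := by
      rw [mul_pow, ha2]
      linarith
    have h6 := le_of_abs_le <| abs_le_of_sq_le_sq h5 (by positivity)
    linarith
  · by_cases hcd : Δx / 2 ≤ c
    · have h1 := aux_rate_lower Δt Δx c hΔt0 hΔx0 hcd
      rw [hceq] at h1
      have h2 := Real.log_le_sub_one_of_pos (x := 1 + rbar * Δt) (by positivity)
      have h3 : rbar * Δt ≤ R * Δt := by gcongr
      have h4 : (c - Δx / 2) ^ 2 / (2 * Δt) ≤ R * Δt := by linarith
      rw [div_le_iff₀ (by positivity)] at h4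
      have h5 : (c - Δx / 2) ^ 2 ≤ (b * Δt) ^ 2 := by
        rw [mul_pow, hb2]
        linarith
      have h6 := le_of_abs_le <| abs_le_of_sq_le_sq h5 (by positivity)
      linarith
    · linarith
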